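/- arXiv:2602.17661 — 4 statements merged into one kernel-verified Lean document; each statement's English description precedes it below -/
import Mathlib

section
/- Let X be a quandle. Choose representatives x_i (i ∈ I) of the orbits of the right action of Inn(X) on X given by x · g = g⁻¹(x), and let H_i = Stab_{Inn(X)}(x_i) be the stabilizer of x_i in Inn(X). Then each H_i is contained in the centralizer C_{Inn(X)}(S_{x_i}), so the coset quandle ⊔_{i∈I}(Inn(X)/H_i, S_{x_i}) is defined, and the map φ : ⊔_{i∈I} Inn(X)/H_i → X sending the right coset H_i g to g⁻¹(x_i) is an isomorphism of quandles. -/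
/-- A quandle structure on a set `X`. -/
structure QuandleStr (X : Type*) where
  op : X → X → X
  idem : ∀ x, op x x = x
  rightBij : ∀ y, Function.Bijective fun x => op x y
  distrib : ∀ x y z, op (op x y) z = op (op x z) (op y z)

/-- The right translation `S_y : x ↦ x ∗ y` as a permutation of `X`. -/
noncomputable def QuandleStr.S {X : Type*} (Q : QuandleStr X) (y : X) : Equiv.Perm X :=
  Equiv.ofBijective _ (Q.rightBij y)

/-- The inner automorphism group of a quandle: the subgroup of permutations
generated by the right translations `S_x`. -/
noncomputable def QInn {X : Type*} (Q : QuandleStr X) : Subgroup (Equiv.Perm X) :=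
  Subgroup.closure (Set.range Q.S)

/-- The right translation `S_y` as an element of the inner automorphism group. -/
noncomputable def qS {X : Type*} (Q : QuandleStr X) (y : X) : ↥(QInn Q) :=
  ⟨Q.S y, Subgroup.subset_closure ⟨y, rfl⟩⟩

/-- The stabilizer of `y ∈ X` in the inner automorphism group of `Q`. -/
noncomputable def qStab {X : Type*} (Q : QuandleStr X) (y : X) : Subgroup ↥(QInn Q) where
  carrier := {g | (g : Equiv.Perm X) y = y}
  one_mem' := rfl
  mul_mem' := by
    intro a b ha hb
    simp only [Set.mem_setOf_eq] at *
    simp [Equiv.Perm.mul_apply, ha, hb]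
  inv_mem' := by
    intro a ha
    simp only [Set.mem_setOf_eq] at *
    nth_rewrite 1 [← ha]
    simp

namespace QuandleStr

variable {X : Type*} (Q : QuandleStr X)

@[simp]
lemma S_apply (x y : X) : Q.S y x = Q.op x y := rfl

/-- The transport of a quandle structure along a bijection. -/
noncomputable def transport {Y : Type*} (e : Y ≃ X) : QuandleStr Y where
  op a b := e.symm (Q.op (e a) (e b))
  idem a := by simp [Q.idem]
  rightBij b := e.symm.bijective.comp ((Q.rightBij (e b)).comp e.bijective)
  distrib a b c := by simp [Q.distrib (e a) (e b) (e c)]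

lemma inn_apply_op {g : Equiv.Perm X} (hg : g ∈ QInn Q) (a b : X) :
    g (Q.op a b) = Q.op (g a) (g b) := by
  induction hg using Subgroup.closure_induction generalizing a b with
  | mem _ h =>
    obtain ⟨y, rfl⟩ := h
    exact Q.distrib a b y
  | one => rfl
  | mul g h _ _ hg hh => simp [hg, hh]
  | inv g _ hg =>
    apply g.injective
    simp [hg]

lemma inn_mul_S {g : Equiv.Perm X} (hg : g ∈ QInn Q) (y : X) : g * Q.S y = Q.S (g y) * g := by
  ext a
  exact Q.inn_apply_op hg a y

lemma stab_le_centralizer (y : X) : qStab Q y ≤ Subgroup.centralizer {qS Q y} := by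
  intro g hg
  rw [Subgroup.mem_centralizer_singleton_iff]
  have hgy : (g : Equiv.Perm X) y = y := hg
  apply Subtype.ext
  have h := Q.inn_mul_S g.2 y
  rw [hgy] at h
  exact h

lemma rightRel_stab_iff (y : X) (g h : QInn Q) :
    QuotientGroup.rightRel (qStab Q y) g h ↔
      (g : Equiv.Perm X)⁻¹ y = (h : Equiv.Perm X)⁻¹ y := by
  rw [QuotientGroup.rightRel_apply]
  change (h : Equiv.Perm X) ((g : Equiv.Perm X)⁻¹ y) = y ↔ _
  rw [Equiv.Perm.eq_inv_iff_eq]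

/-- The map sending the right coset of `g` at index `i` to `g⁻¹ (x i)`. -/
noncomputable def cosetMap {I : Type*} (x : I → X) :
    (Σ i : I, Quotient (QuotientGroup.rightRel (qStab Q (x i)))) → X := fun a =>
  Quotient.lift (fun g : QInn Q => (g : Equiv.Perm X)⁻¹ (x a.1))
    (fun g h hgh => (Q.rightRel_stab_iff (x a.1) g h).1 hgh) a.2

lemma cosetMap_bijective {I : Type*} (x : I → X)
    (hsurj : ∀ y : X, ∃ (i : I) (g : QInn Q), (g : Equiv.Perm X)⁻¹ (x i) = y)
    (hdisj : ∀ (i j : I) (g : QInn Q), (g : Equiv.Perm X)⁻¹ (x i) = x j → i = j) :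
    Function.Bijective (Q.cosetMap x) := by
  refine ⟨?_, fun y => ?_⟩
  · rintro ⟨i, a⟩ ⟨j, b⟩ hab
    induction a using Quotient.inductionOn with | _ g
    induction b using Quotient.inductionOn with | _ h
    change (g : Equiv.Perm X)⁻¹ (x i) = (h : Equiv.Perm X)⁻¹ (x j) at hab
    obtain rfl : i = j := hdisj i j (g * h⁻¹) (by
      change (h : Equiv.Perm X) ((g : Equiv.Perm X)⁻¹ (x i)) = x j
      rw [hab]
      exact (h : Equiv.Perm X).apply_symm_apply (x j))
    rw [Quotient.sound ((Q.rightRel_stab_iff (x i) g h).2 hab)]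
  · obtain ⟨i, g, hg⟩ := hsurj y
    exact ⟨⟨i, Quotient.mk _ g⟩, hg⟩

lemma inv_coset_op_apply (y z : X) (g h : QInn Q) :
    ((qS Q y * g * h⁻¹ * (qS Q z)⁻¹ * h : QInn Q) : Equiv.Perm X)⁻¹ y =
      Q.op ((g : Equiv.Perm X)⁻¹ y) ((h : Equiv.Perm X)⁻¹ z) := by
  have hy : (Q.S y).symm y = y := by
    rw [Equiv.symm_apply_eq, S_apply, Q.idem]
  have hh := Q.inn_apply_op (inv_mem h.2) ((h : Equiv.Perm X) ((g : Equiv.Perm X)⁻¹ y)) z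
  simpa [qS, mul_inv_rev, hy] using hh

end QuandleStr

/-- Every quandle `X` is isomorphic to the coset quandle
`⊔_{i∈I}(Inn(X)/H_i, S_{x_i})`, where the `x_i` are representatives of the orbits of
the right action `x · g = g⁻¹(x)` of `Inn(X)` on `X` and `H_i = Stab_{Inn(X)}(x_i)`:
each `H_i` is contained in the centralizer of `S_{x_i}`, the coset quandle exists, and
`H_i g ↦ g⁻¹(x_i)` is a well-defined quandle isomorphism. -/
theorem quandle_iso_coset_quandle {X : Type*} (Q : QuandleStr X) {I : Type*} (x : I → X)
    (hsurj : ∀ y : X, ∃ (i : I) (g : ↥(QInn Q)), ((g : Equiv.Perm X))⁻¹ (x i) = y)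
    (hdisj : ∀ (i j : I) (g : ↥(QInn Q)), ((g : Equiv.Perm X))⁻¹ (x i) = x j → i = j) :
    (∀ i : I, qStab Q (x i) ≤ Subgroup.centralizer {qS Q (x i)}) ∧
    ∃ Qc : QuandleStr (Σ i : I, Quotient (QuotientGroup.rightRel (qStab Q (x i)))),
      (∀ (i j : I) (g h : ↥(QInn Q)),
        Qc.op ⟨i, Quotient.mk (QuotientGroup.rightRel (qStab Q (x i))) g⟩
              ⟨j, Quotient.mk (QuotientGroup.rightRel (qStab Q (x j))) h⟩ =
          ⟨i, Quotient.mk (QuotientGroup.rightRel (qStab Q (x i)))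
                (qS Q (x i) * g * h⁻¹ * (qS Q (x j))⁻¹ * h)⟩) ∧
      ∃ φ : (Σ i : I, Quotient (QuotientGroup.rightRel (qStab Q (x i)))) → X,
        (∀ (i : I) (g : ↥(QInn Q)),
            φ ⟨i, Quotient.mk (QuotientGroup.rightRel (qStab Q (x i))) g⟩ =
              ((g : Equiv.Perm X))⁻¹ (x i)) ∧
        Function.Bijective φ ∧
        (∀ a b, φ (Qc.op a b) = Q.op (φ a) (φ b)) := by
  refine ⟨fun i => Q.stab_le_centralizer (x i), ?_⟩
  have hbij := Q.cosetMap_bijective x hsurj hdisj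
  let e := Equiv.ofBijective _ hbij
  refine ⟨Q.transport e, fun i j g h => ?_, Q.cosetMap x, fun _ _ => rfl, hbij,
    fun a b => e.apply_symm_apply _⟩
  exact e.symm_apply_eq.2 (Q.inv_coset_op_apply (x i) (x j) g h).symm
end

section
/- Let X be a quandle, A an abelian group, and φ : X × X → A a quandle 2-cocycle. Then the operation (x, a) ⋆ (y, b) = (x ∗ y, a + φ(x, y)) makes E = X × A a quandle, and the projection π : E → X, (x, a) ↦ x, is a quandle covering: π is a surjective quandle homomorphism and the right translations S_{(x,a)} and S_{(x',a')} of E coincide whenever x = x'. -/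
/-- The abelian extension `X ×_φ A` of a quandle by a quandle 2-cocycle. -/
def QuandleStr.abelianExtension {X A : Type*} [AddCommGroup A]
    (Q : QuandleStr X) (φ : X → X → A)
    (hdiag : ∀ x, φ x x = 0)
    (hcoc : ∀ x y z, φ x y + φ (Q.op x y) z = φ x z + φ (Q.op x z) (Q.op y z)) :
    QuandleStr (X × A) where
  op p q := (Q.op p.1 q.1, p.2 + φ p.1 q.1)
  idem p := by simp [Q.idem, hdiag]
  rightBij := by
    rintro ⟨y, b⟩
    constructor
    · rintro ⟨x, a⟩ ⟨x', a'⟩ h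
      obtain ⟨hx, ha⟩ := Prod.mk.inj h
      obtain rfl : x = x' := (Q.rightBij y).injective hx
      exact Prod.ext rfl (add_right_cancel ha)
    · rintro ⟨x, a⟩
      obtain ⟨x', rfl⟩ := (Q.rightBij y).surjective x
      exact ⟨(x', a - φ x' y), by simp⟩
  distrib p q r := Prod.ext (Q.distrib _ _ _) (by
    simp only [add_assoc]
    rw [hcoc])

/-- Let `X` be a quandle, `A` an abelian group and `φ` a quandle
2-cocycle on `X` with values in `A`.  Then `(x,a) ⋆ (y,b) = (x∗y, a + φ x y)` makes
`E = X × A` a quandle, and the projection `π : E → X` is a quandle covering: it is a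
surjective quandle homomorphism, and right translations by `(x,a)` and `(x',a')`
coincide whenever `x = x'`. -/
theorem abelian_extension_is_quandle_covering {X A : Type*} [AddCommGroup A]
    (Q : QuandleStr X) (φ : X → X → A)
    (hdiag : ∀ x, φ x x = 0)
    (hcoc : ∀ x y z, φ x y + φ (Q.op x y) z = φ x z + φ (Q.op x z) (Q.op y z)) :
    ∃ Qe : QuandleStr (X × A),
      (∀ (x y : X) (a b : A), Qe.op (x, a) (y, b) = (Q.op x y, a + φ x y)) ∧
      Function.Surjective (fun p : X × A => p.1) ∧
      (∀ p q : X × A, (Qe.op p q).1 = Q.op p.1 q.1) ∧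
      (∀ p p' : X × A, p.1 = p'.1 → ∀ w : X × A, Qe.op w p = Qe.op w p') := by
  exact ⟨Q.abelianExtension φ hdiag hcoc, fun _ _ _ _ => rfl, Prod.fst_surjective,
    fun _ _ => rfl, fun _ _ h _ => by simp only [QuandleStr.abelianExtension, h]⟩
end

section
/- Let X be a quandle and x₁, …, x_r ∈ X distinct elements satisfying x_i ∗ x_j = x_i for all 1 ≤ i, j ≤ r. If n₁, …, n_r are integers with n₁ + ⋯ + n_r = 1, then the element u = n₁x₁ + ⋯ + n_r x_r of the integral quandle ring ℤ[X] is an idempotent: u² = u. -/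
/-- Let `X` be a quandle (written multiplicatively: `x * y = x ∗ y`)
and `x₁, …, x_r ∈ X` distinct elements with `x_i ∗ x_j = x_i` for all `i, j`.  If
`n₁, …, n_r` are integers with `n₁ + ⋯ + n_r = 1`, then `u = Σ n_i x_i` is an
idempotent of the integral quandle ring `ℤ[X]`. -/
theorem convex_combination_idempotent {X : Type*} [Mul X]
    (hidem : ∀ x : X, x * x = x)
    (hbij : ∀ y : X, Function.Bijective fun x : X => x * y)
    (hdist : ∀ x y z : X, (x * y) * z = (x * z) * (y * z))
    (r : ℕ) (x : Fin r → X) (hinj : Function.Injective x)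
    (hfix : ∀ i j : Fin r, x i * x j = x i)
    (n : Fin r → ℤ) (hsum : ∑ i, n i = 1) :
    (∑ i, MonoidAlgebra.single (x i) (n i) : MonoidAlgebra ℤ X) *
        (∑ i, MonoidAlgebra.single (x i) (n i)) =
      ∑ i, MonoidAlgebra.single (x i) (n i) := by
  rw [Finset.sum_mul_sum]
  simp only [MonoidAlgebra.single_mul_single, hfix]
  refine Finset.sum_congr rfl fun i _ => ?_
  calc ∑ j, MonoidAlgebra.single (x i) (n i * n j)
      = MonoidAlgebra.single (x i) (∑ j, n i * n j) :=
        (map_sum (MonoidAlgebra.singleAddHom (x i)) _ _).symm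
    _ = MonoidAlgebra.single (x i) (n i) := by rw [← Finset.mul_sum, hsum, mul_one]
end

section
/- Let X be a quandle, x₁ ≠ x₂ elements of X, and n₁, n₂ nonzero integers. (i) If the four elements x₁, x₂, x₁ ∗ x₂, x₂ ∗ x₁ are pairwise distinct, then n₁x₁ + n₂x₂ is not an idempotent of the integral quandle ring ℤ[X]. (ii) If x₁ ∗ x₂ = x₁ and x₂ ∗ x₁ = x₂, then n₁x₁ + n₂x₂ is an idempotent of ℤ[X] if and only if n₁ + n₂ = 1. -/
/-- The square of an element of length two in the magma algebra of an idempotent magma. -/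
theorem MonoidAlgebra.single_add_single_mul_self {R X : Type*} [Semiring R] [Mul X]
    (hidem : ∀ x : X, x * x = x) (x y : X) (a b : R) :
    (MonoidAlgebra.single x a + MonoidAlgebra.single y b : MonoidAlgebra R X) *
        (MonoidAlgebra.single x a + MonoidAlgebra.single y b) =
      MonoidAlgebra.single x (a * a) + MonoidAlgebra.single (x * y) (a * b) +
        (MonoidAlgebra.single (y * x) (b * a) + MonoidAlgebra.single y (b * b)) := by
  simp only [add_mul, mul_add, MonoidAlgebra.single_mul_single, hidem]
  abel

/-- Let `X` be a quandle (written multiplicatively: `x * y = x ∗ y`),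
`x₁ ≠ x₂` elements of `X` and `n₁, n₂` nonzero integers.
(i) If `x₁, x₂, x₁ ∗ x₂, x₂ ∗ x₁` are pairwise distinct, then `n₁x₁ + n₂x₂` is not an
idempotent of `ℤ[X]`.
(ii) If `x₁ ∗ x₂ = x₁` and `x₂ ∗ x₁ = x₂`, then `n₁x₁ + n₂x₂` is an idempotent of
`ℤ[X]` if and only if `n₁ + n₂ = 1`. -/
theorem length_two_idempotents {X : Type*} [Mul X]
    (hidem : ∀ x : X, x * x = x)
    (hbij : ∀ y : X, Function.Bijective fun x : X => x * y)
    (hdist : ∀ x y z : X, (x * y) * z = (x * z) * (y * z))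
    (x₁ x₂ : X) (hx : x₁ ≠ x₂) (n₁ n₂ : ℤ) (hn₁ : n₁ ≠ 0) (hn₂ : n₂ ≠ 0) :
    (([x₁, x₂, x₁ * x₂, x₂ * x₁].Pairwise (· ≠ ·)) →
      ¬ ((MonoidAlgebra.single x₁ n₁ + MonoidAlgebra.single x₂ n₂ :
            MonoidAlgebra ℤ X) *
          (MonoidAlgebra.single x₁ n₁ + MonoidAlgebra.single x₂ n₂) =
        MonoidAlgebra.single x₁ n₁ + MonoidAlgebra.single x₂ n₂)) ∧
    ((x₁ * x₂ = x₁ ∧ x₂ * x₁ = x₂) →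
      (((MonoidAlgebra.single x₁ n₁ + MonoidAlgebra.single x₂ n₂ :
            MonoidAlgebra ℤ X) *
          (MonoidAlgebra.single x₁ n₁ + MonoidAlgebra.single x₂ n₂) =
        MonoidAlgebra.single x₁ n₁ + MonoidAlgebra.single x₂ n₂) ↔ n₁ + n₂ = 1)) := by
  rw [MonoidAlgebra.single_add_single_mul_self hidem]
  refine ⟨fun hd h => ?_, fun ⟨h₁, h₂⟩ => ?_⟩
  · simp only [List.pairwise_cons, List.mem_cons, List.not_mem_nil, or_false, forall_eq_or_imp,
      forall_eq] at hd
    obtain ⟨⟨-, h₁, -⟩, ⟨h₂, -⟩, h₃, -⟩ := hd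
    have hc := congrArg (fun u : MonoidAlgebra ℤ X => u.coeff (x₁ * x₂)) h
    simp [h₁, h₂, h₃.symm, hn₁, hn₂] at hc
  · rw [h₁, h₂, ← MonoidAlgebra.single_add, ← MonoidAlgebra.single_add, ← mul_add, ← mul_add]
    refine ⟨fun h => ?_, fun h => by rw [h, mul_one, mul_one]⟩
    have hc := congrArg (fun u : MonoidAlgebra ℤ X => u.coeff x₁) h
    simpa [Finsupp.single_apply, hx.symm, hn₁] using hc
end
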